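/- arXiv:1501.04150 — 2 statements merged into one kernel-verified Lean document; each statement's English description precedes it below -/
import Mathlib

section
/- Let K > 0 and c ≥ e, and define φ : (0, ∞) → (0, ∞) by φ(s) = K (log(c + s⁻¹))^{−1/2}. Then ∫₀¹ 1 / ( t (1 + ∫ₜ¹ φ(s)/s ds)² ) dt = ∞. -/
open MeasureTheory Set Filter Topology in
/-- `1 / (t (1 - log t))` is not integrable near zero. -/
lemma not_integrableOn_one_div_mul_one_sub_log :
    ¬ IntegrableOn (fun t : ℝ => 1 / (t * (1 - Real.log t))) (Ioc 0 1) := by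
  have hderiv : ∀ t : ℝ, 0 < t → t < 1 →
      HasDerivAt (fun t => Real.log (1 - Real.log t)) (-t⁻¹ / (1 - Real.log t)) t := by
    intro t h0 h1
    have hlog := Real.log_neg h0 h1
    exact ((Real.hasDerivAt_log h0.ne').const_sub 1).log (by linarith)
  have hnear : ∀ᶠ t : ℝ in 𝓝[>] 0, 0 < t ∧ t < 1 :=
    Ioo_mem_nhdsGT one_pos
  refine not_integrableOn_of_tendsto_norm_atTop_of_deriv_isBigO_filter
    (l := 𝓝[>] (0 : ℝ)) (f := fun t => Real.log (1 - Real.log t))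
    (Ioc_mem_nhdsGT one_pos) ?_ ?_ ?_
  · filter_upwards [hnear] with t ht
    exact (hderiv t ht.1 ht.2).differentiableAt
  · refine tendsto_norm_atTop_atTop.comp (Real.tendsto_log_atTop.comp ?_)
    exact tendsto_atTop_add_const_left _ 1
      (tendsto_neg_atBot_atTop.comp Real.tendsto_log_nhdsGT_zero)
  · refine Asymptotics.IsBigO.of_bound 1 ?_
    filter_upwards [hnear] with t ht
    rw [(hderiv t ht.1 ht.2).deriv, one_mul, neg_div, norm_neg, inv_eq_one_div, div_div]

/-- For `c ≥ e` and `s > 0`, `log (c + s⁻¹)` is at least a quarter of `1 - log s`. -/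
lemma one_sub_log_le_four_mul_log_add_inv {c s : ℝ} (hc : Real.exp 1 ≤ c) (hs : 0 < s) :
    1 - Real.log s ≤ 4 * Real.log (c + s⁻¹) := by
  have hinv := inv_pos.2 hs
  have hexp := Real.exp_pos 1
  have h1 : 1 ≤ Real.log (c + s⁻¹) := by
    rw [Real.le_log_iff_exp_le (by linarith)]
    linarith
  have h2 : -Real.log s ≤ Real.log (c + s⁻¹) := by
    rw [← Real.log_inv]
    exact Real.log_le_log hinv (by linarith)
  linarith

lemma rpow_log_add_inv_le {c s : ℝ} (hc : Real.exp 1 ≤ c) (hs : 0 < s) (hs1 : s ≤ 1) :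
    Real.log (c + s⁻¹) ^ (-(1 / 2 : ℝ)) ≤ 2 / √(1 - Real.log s) := by
  have hlog := Real.log_nonpos hs.le hs1
  have hle := one_sub_log_le_four_mul_log_add_inv hc hs
  have hpos : 0 < Real.log (c + s⁻¹) := by linarith
  rw [Real.rpow_neg hpos.le, ← Real.sqrt_eq_rpow, inv_eq_one_div,
    div_le_div_iff₀ (Real.sqrt_pos.2 hpos) (Real.sqrt_pos.2 (by linarith)), one_mul]
  calc √(1 - Real.log s) ≤ √(2 ^ 2 * Real.log (c + s⁻¹)) :=
        Real.sqrt_le_sqrt (by linarith)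
    _ = 2 * √(Real.log (c + s⁻¹)) := by
        rw [Real.sqrt_mul (by norm_num), Real.sqrt_sq (by norm_num)]

open MeasureTheory Set in
lemma integral_div_mul_sqrt_one_sub_log (a : ℝ) {t : ℝ} (ht : 0 < t) (ht1 : t ≤ 1) :
    IntervalIntegrable (fun s => a / (s * √(1 - Real.log s))) volume t 1 ∧
      ∫ s in t..1, a / (s * √(1 - Real.log s)) = 2 * a * (√(1 - Real.log t) - 1) := by
  have hpos : ∀ s ∈ uIcc t 1, 0 < s ∧ 0 < 1 - Real.log s := by
    intro s hs
    rw [uIcc_of_le ht1] at hs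
    have h0 := ht.trans_le hs.1
    have := Real.log_nonpos h0.le hs.2
    exact ⟨h0, by linarith⟩
  have hint : IntervalIntegrable (fun s => a / (s * √(1 - Real.log s))) volume t 1 := by
    refine ContinuousOn.intervalIntegrable (continuousOn_const.div ?_ ?_)
    · exact continuousOn_id.mul (continuousOn_const.sub
        (Real.continuousOn_log.mono fun s hs => (hpos s hs).1.ne')).sqrt
    · exact fun s hs => mul_ne_zero (hpos s hs).1.ne' (Real.sqrt_pos.2 (hpos s hs).2).ne'
  refine ⟨hint, ?_⟩
  rw [intervalIntegral.integral_eq_sub_of_hasDerivAt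
    (f := fun s => -(2 * a) * √(1 - Real.log s)) (fun s hs => ?_) hint]
  · simp
    ring
  · obtain ⟨h0, h1⟩ := hpos s hs
    have hsqrt := Real.sqrt_pos.2 h1
    refine ((((Real.hasDerivAt_log h0.ne').const_sub 1).sqrt h1.ne').const_mul
      (-(2 * a))).congr_deriv ?_
    field_simp

open MeasureTheory Set in
/-- For `φ(s) = K (log(c + s⁻¹))^{-1/2}`, one has
`∫₀¹ dt / (t (1 + ∫ₜ¹ φ(s)/s ds)²) = ∞`. -/
theorem stmt_7 (K c : ℝ) (hK : 0 < K) (hc : Real.exp 1 ≤ c)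
    (φ : ℝ → ℝ)
    (hφ : ∀ s : ℝ, 0 < s → φ s = K * Real.log (c + s⁻¹) ^ (-(1 / 2 : ℝ))) :
    ∫⁻ t in Set.Ioc (0 : ℝ) 1,
        ENNReal.ofReal (1 / (t * (1 + ∫ s in t..(1 : ℝ), φ s / s) ^ 2)) = ⊤ := by
  set A : ℝ := 1 + 4 * K with hA
  have hApos : 0 < A := by positivity
  have hφ0 : ∀ s : ℝ, 0 < s → 0 ≤ φ s / s := by
    intro s hs
    have hinv := inv_pos.2 hs
    have hone := Real.add_one_le_exp 1
    have hlog : 0 ≤ Real.log (c + s⁻¹) := Real.log_nonneg (by linarith)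
    rw [hφ s hs]
    positivity
  have hinner : ∀ t ∈ Ioc (0 : ℝ) 1, 0 ≤ ∫ s in t..(1 : ℝ), φ s / s ∧
      1 + ∫ s in t..(1 : ℝ), φ s / s ≤ A * √(1 - Real.log t) := by
    intro t ht
    have hlog := Real.log_nonpos ht.1.le ht.2
    have hsqrt : 1 ≤ √(1 - Real.log t) := Real.one_le_sqrt.2 (by linarith)
    refine ⟨intervalIntegral.integral_nonneg ht.2 fun s hs => hφ0 s (ht.1.trans_le hs.1), ?_⟩
    obtain ⟨hint, heq⟩ := integral_div_mul_sqrt_one_sub_log (2 * K) ht.1 ht.2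
    have hle : ∫ s in t..(1 : ℝ), φ s / s ≤
        ∫ s in t..(1 : ℝ), 2 * K / (s * √(1 - Real.log s)) := by
      rw [intervalIntegral.integral_of_le ht.2, intervalIntegral.integral_of_le ht.2]
      refine integral_mono_of_nonneg ?_ hint.1 ?_
      · filter_upwards [ae_restrict_mem measurableSet_Ioc] with s hs
        exact hφ0 s (ht.1.trans hs.1)
      · filter_upwards [ae_restrict_mem measurableSet_Ioc] with s hs
        have h0 := ht.1.trans hs.1
        rw [hφ s h0, mul_comm s, ← div_div]
        refine div_le_div_of_nonneg_right ?_ h0.le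
        calc K * Real.log (c + s⁻¹) ^ (-(1 / 2 : ℝ)) ≤ K * (2 / √(1 - Real.log s)) :=
              mul_le_mul_of_nonneg_left (rpow_log_add_inv_le hc h0 hs.2) hK.le
          _ = 2 * K / √(1 - Real.log s) := by ring
    rw [heq] at hle
    rw [hA]
    nlinarith
  by_contra hfin
  have hbound : ∀ t ∈ Ioc (0 : ℝ) 1, (A ^ 2)⁻¹ * (1 / (t * (1 - Real.log t))) ≤
      1 / (t * (1 + ∫ s in t..(1 : ℝ), φ s / s) ^ 2) := by
    intro t ht
    obtain ⟨h0, hle⟩ := hinner t ht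
    have hlog := Real.log_nonpos ht.1.le ht.2
    have hsq : (1 + ∫ s in t..(1 : ℝ), φ s / s) ^ 2 ≤ A ^ 2 * (1 - Real.log t) := by
      rw [← Real.sq_sqrt (show 0 ≤ 1 - Real.log t by linarith), ← mul_pow]
      exact pow_le_pow_left₀ (by linarith) hle 2
    rw [inv_eq_one_div, one_div_mul_one_div, mul_left_comm]
    have ht0 := ht.1
    exact one_div_le_one_div_of_le (by positivity) (mul_le_mul_of_nonneg_left hsq ht0.le)
  have hintegrable : IntegrableOn
      (fun t : ℝ => (A ^ 2)⁻¹ * (1 / (t * (1 - Real.log t)))) (Ioc 0 1) := by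
    refine ⟨Measurable.aestronglyMeasurable (by fun_prop), ?_⟩
    rw [hasFiniteIntegral_iff_ofReal]
    · refine lt_of_le_of_lt (setLIntegral_mono' measurableSet_Ioc fun t ht => ?_)
        (lt_top_iff_ne_top.2 hfin)
      exact ENNReal.ofReal_le_ofReal (hbound t ht)
    · filter_upwards [ae_restrict_mem measurableSet_Ioc] with t ht
      have hlog := Real.log_nonpos ht.1.le ht.2
      exact mul_nonneg (by positivity)
        (one_div_nonneg.2 (mul_nonneg ht.1.le (by linarith)))
  refine not_integrableOn_one_div_mul_one_sub_log ?_
  refine (hintegrable.const_mul (A ^ 2)).congr (Filter.Eventually.of_forall fun t => ?_)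
  exact mul_inv_cancel_left₀ (by positivity) _
end

section
/- Let T > 0, δ ∈ (0, 1), C > 0, and let φ : [0, ∞) → [0, ∞) be increasing. There exists a constant C' > 0 such that for every a ≥ 0 and every r ∈ (0, 1): ∫₀^T min( s^{−1/2}, a φ(C s^{δ/2}) / s ) ds ≤ C' r + C' a ( 1 + ∫_{r^δ}¹ φ(s)/s ds ). -/
open MeasureTheory Set

/-- A function monotone on `[0, ∞)` is integrable against `ds / s` away from the origin. -/
lemma MonotoneOn.intervalIntegrable_div_self {g : ℝ → ℝ} (hg : MonotoneOn g (Ici 0))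
    {x y : ℝ} (hx : 0 < x) (hy : 0 < y) :
    IntervalIntegrable (fun s => g s / s) volume x y := by
  have hsub : uIcc x y ⊆ Ioi 0 := fun s hs => (lt_min hx hy).trans_le hs.1
  have hmono : IntervalIntegrable g volume x y :=
    (hg.mono (hsub.trans Ioi_subset_Ici_self)).intervalIntegrable
  simp only [div_eq_mul_inv]
  exact hmono.mul_continuousOn
    (continuousOn_id.inv₀ fun s hs => (hsub hs).ne')

/-- The substitution `u = C s ^ p` in an integral against `ds / s`. -/
lemma integral_comp_const_mul_rpow_div_self (g : ℝ → ℝ) {C p x y : ℝ} (hC : 0 < C) (hp : 0 < p)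
    (hx : 0 < x) (hxy : x ≤ y) :
    ∫ s in x..y, g (C * s ^ p) / s = p⁻¹ * ∫ u in (C * x ^ p)..(C * y ^ p), g u / u := by
  have hpos : ∀ s ∈ Icc x y, 0 < s := fun s hs => hx.trans_le hs.1
  have hstrict : StrictMonoOn (fun s : ℝ => C * s ^ p) (Icc x y) := fun s hs t _ hst =>
    mul_lt_mul_of_pos_left (Real.rpow_lt_rpow (hpos s hs).le hst hp) hC
  have hcont : ContinuousOn (fun s : ℝ => C * s ^ p) (Icc x y) :=
    continuousOn_const.mul (continuousOn_id.rpow_const fun _ _ => Or.inr hp.le)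
  have hderiv : ∀ s ∈ Icc x y,
      HasDerivWithinAt (fun s : ℝ => C * s ^ p) (C * (p * s ^ (p - 1))) (Icc x y) s :=
    fun s hs => ((Real.hasDerivAt_rpow_const (Or.inl (hpos s hs).ne')).const_mul C).hasDerivWithinAt
  have himage : (fun s : ℝ => C * s ^ p) '' Icc x y = Icc (C * x ^ p) (C * y ^ p) :=
    hcont.image_Icc_of_monotoneOn hxy hstrict.monotoneOn
  have key := integral_image_eq_integral_abs_deriv_smul measurableSet_Icc hderiv hstrict.injOn
    (fun u => g u / u)
  have hle : C * x ^ p ≤ C * y ^ p :=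
    hstrict.monotoneOn (left_mem_Icc.2 hxy) (right_mem_Icc.2 hxy) hxy
  rw [intervalIntegral.integral_of_le hxy, intervalIntegral.integral_of_le hle,
    ← integral_Icc_eq_integral_Ioc, ← integral_Icc_eq_integral_Ioc, ← himage, key,
    ← integral_const_mul]
  refine setIntegral_congr_fun measurableSet_Icc fun s hs => ?_
  have hs0 := hpos s hs
  have hsp : 0 < s ^ p := Real.rpow_pos_of_pos hs0 p
  simp only [smul_eq_mul]
  rw [Real.rpow_sub_one hs0.ne', abs_of_pos (by positivity)]
  field_simp

/-- Splitting the integral of `min (s ^ (-1/2)) (h s / s)` at `x`, for a monotone `h`. -/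
lemma integral_min_rpow_div_self_le {h : ℝ → ℝ} (hh : MonotoneOn h (Ici 0))
    (hnn : ∀ s, 0 ≤ s → 0 ≤ h s) {x y : ℝ} (hx : 0 < x) (hxy : x ≤ y) :
    IntegrableOn (fun s => min (s ^ (-(1 / 2 : ℝ))) (h s / s)) (Ioc 0 y) ∧
      ∫ s in (0 : ℝ)..y, min (s ^ (-(1 / 2 : ℝ))) (h s / s)
        ≤ 2 * x ^ (1 / 2 : ℝ) + ∫ s in x..y, h s / s := by
  have hy := hx.trans_le hxy
  have hrpow : ∀ z : ℝ, IntervalIntegrable (fun s : ℝ => s ^ (-(1 / 2 : ℝ))) volume 0 z :=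
    fun z => intervalIntegral.intervalIntegrable_rpow' (by norm_num)
  have hmeas : AEStronglyMeasurable (fun s => min (s ^ (-(1 / 2 : ℝ))) (h s / s))
      (volume.restrict (Ioc 0 y)) := by
    have h1 : AEMeasurable h (volume.restrict (Ioc 0 y)) :=
      aemeasurable_restrict_of_monotoneOn measurableSet_Ioc
        (hh.mono fun s hs => hs.1.le)
    have h2 : Measurable fun s : ℝ => s ^ (-(1 / 2 : ℝ)) := by fun_prop
    exact (h2.aemeasurable.min (h1.div aemeasurable_id)).aestronglyMeasurable
  have hint : IntegrableOn (fun s => min (s ^ (-(1 / 2 : ℝ))) (h s / s)) (Ioc 0 y) := by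
    refine Integrable.mono' ((intervalIntegrable_iff_integrableOn_Ioc_of_le hy.le).1 (hrpow y))
      hmeas ((ae_restrict_iff' measurableSet_Ioc).2 (.of_forall fun s hs => ?_))
    have : 0 ≤ min (s ^ (-(1 / 2 : ℝ))) (h s / s) :=
      le_min (Real.rpow_nonneg hs.1.le _) (div_nonneg (hnn s hs.1.le) hs.1.le)
    rw [Real.norm_of_nonneg this]
    exact min_le_left _ _
  refine ⟨hint, ?_⟩
  have hint' := (intervalIntegrable_iff_integrableOn_Ioc_of_le hy.le).2 hint
  have hx_mem : x ∈ uIcc 0 y := by rw [uIcc_of_le hy.le]; exact ⟨hx.le, hxy⟩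
  have hint₁ := hint'.mono_set (uIcc_subset_uIcc left_mem_uIcc hx_mem)
  have hint₂ := hint'.mono_set (uIcc_subset_uIcc hx_mem right_mem_uIcc)
  rw [← intervalIntegral.integral_add_adjacent_intervals hint₁ hint₂]
  refine add_le_add ?_ (intervalIntegral.integral_mono_on hxy hint₂
    (hh.intervalIntegrable_div_self hx hy) fun s _ => min_le_right _ _)
  refine (intervalIntegral.integral_mono_on hx.le hint₁ (hrpow x)
    fun s _ => min_le_left _ _).trans_eq ?_
  rw [integral_rpow (Or.inl (by norm_num))]
  norm_num
  ring


/-- The kernel estimate inside Corollary 2.4(3):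
`∫₀^T min(s^{−1/2}, a φ(C s^{δ/2})/s) ds ≤ C' r + C' a (1 + ∫_{r^δ}¹ φ(s)/s ds)`. -/
theorem stmt_12 (T δ C : ℝ) (hT : 0 < T) (hδ : δ ∈ Set.Ioo (0 : ℝ) 1) (hC : 0 < C)
    (φ : ℝ → ℝ) (hmono : MonotoneOn φ (Set.Ici 0)) (hnn : ∀ s : ℝ, 0 ≤ s → 0 ≤ φ s) :
    ∃ C' > (0 : ℝ), ∀ a : ℝ, 0 ≤ a → ∀ r ∈ Set.Ioo (0 : ℝ) 1,
      (∫ s in Set.Ioc (0 : ℝ) T, min (s ^ (-(1 / 2 : ℝ))) (a * φ (C * s ^ (δ / 2)) / s))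
        ≤ C' * r + C' * a * (1 + ∫ s in (r ^ δ)..(1 : ℝ), φ s / s) := by
  obtain ⟨hδ0, -⟩ := hδ
  have hp : 0 < δ / 2 := half_pos hδ0
  set V := max 1 (C * T ^ (δ / 2))
  have hV1 : 1 ≤ V := le_max_left _ _
  set K := ∫ u in (1 : ℝ)..V, φ u / u with hK
  have hdiv : ∀ u : ℝ, 0 < u → 0 ≤ φ u / u := fun u hu => div_nonneg (hnn u hu.le) hu.le
  have hK0 : 0 ≤ K :=
    intervalIntegral.integral_nonneg hV1 fun u hu => hdiv u (one_pos.trans_le hu.1)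
  have hinv : ∀ v : ℝ, 0 < v → C * ((v / C) ^ (δ / 2)⁻¹) ^ (δ / 2) = v := fun v hv => by
    rw [Real.rpow_inv_rpow (div_pos hv hC).le hp.ne', mul_div_cancel₀ _ hC.ne']
  set D := (C ^ δ⁻¹)⁻¹ with hD
  have hD0 : 0 < D := inv_pos.2 (Real.rpow_pos_of_pos hC _)
  have hδ' : 0 < (δ / 2)⁻¹ := inv_pos.2 hp
  refine ⟨2 * D + (δ / 2)⁻¹ * (1 + K), by positivity, fun a ha r hr => ?_⟩
  have hrδ : 0 < r ^ δ := Real.rpow_pos_of_pos hr.1 _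
  have hrδ1 : r ^ δ ≤ 1 := Real.rpow_le_one hr.1.le hr.2.le hδ0.le
  set J := ∫ u in (r ^ δ)..(1 : ℝ), φ u / u with hJ
  have hJ0 : 0 ≤ J :=
    intervalIntegral.integral_nonneg hrδ1 fun u hu => hdiv u (hrδ.trans_le hu.1)
  set x := (r ^ δ / C) ^ (δ / 2)⁻¹ with hx
  set y := (V / C) ^ (δ / 2)⁻¹ with hy
  have hx0 : 0 < x := Real.rpow_pos_of_pos (div_pos hrδ hC) _
  have hxy : x ≤ y := Real.rpow_le_rpow (div_pos hrδ hC).le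
    (div_le_div_of_nonneg_right (hrδ1.trans hV1) hC.le) hδ'.le
  have hTy : T ≤ y := by
    rw [hy, Real.le_rpow_inv_iff_of_pos hT.le (by positivity) hp, le_div_iff₀ hC, mul_comm]
    exact le_max_right _ _
  have hxD : x ^ (1 / 2 : ℝ) = D * r := by
    rw [hx, ← Real.rpow_mul (div_pos hrδ hC).le,
      show (δ / 2)⁻¹ * (1 / 2) = δ⁻¹ by field_simp, Real.div_rpow hrδ.le hC.le,
      Real.rpow_rpow_inv hr.1.le hδ0.ne', hD, div_eq_inv_mul]
  have hhmono : MonotoneOn (fun s => a * φ (C * s ^ (δ / 2))) (Set.Ici 0) :=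
    fun s hs t ht hst => mul_le_mul_of_nonneg_left
      (hmono (mul_nonneg hC.le (Real.rpow_nonneg hs _)) (mul_nonneg hC.le (Real.rpow_nonneg ht _))
        (mul_le_mul_of_nonneg_left (Real.rpow_le_rpow hs hst hp.le) hC.le)) ha
  have hhnn : ∀ s, 0 ≤ s → 0 ≤ a * φ (C * s ^ (δ / 2)) := fun s hs =>
    mul_nonneg ha (hnn _ (mul_nonneg hC.le (Real.rpow_nonneg hs _)))
  obtain ⟨hint, hle⟩ := integral_min_rpow_div_self_le hhmono hhnn hx0 hxy
  have hsubst : ∫ s in x..y, a * φ (C * s ^ (δ / 2)) / s = a * ((δ / 2)⁻¹ * (J + K)) := by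
    simp only [mul_div_assoc]
    rw [intervalIntegral.integral_const_mul,
      integral_comp_const_mul_rpow_div_self φ hC hp hx0 hxy, hinv _ hrδ,
      hinv _ (one_pos.trans_le hV1), hJ, hK,
      intervalIntegral.integral_add_adjacent_intervals
        (hmono.intervalIntegrable_div_self hrδ one_pos)
        (hmono.intervalIntegrable_div_self one_pos (one_pos.trans_le hV1))]
  rw [hxD, hsubst, intervalIntegral.integral_of_le (hx0.le.trans hxy)] at hle
  have hmono_set := setIntegral_mono_set hint
    ((ae_restrict_iff' measurableSet_Ioc).2 (.of_forall fun s hs =>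
      le_min (Real.rpow_nonneg hs.1.le _) (div_nonneg (hhnn s hs.1.le) hs.1.le)))
    (Ioc_subset_Ioc_right hTy).eventuallyLE
  refine (hmono_set.trans hle).trans ?_
  have h1 : 0 ≤ (δ / 2)⁻¹ * (1 + K) * r := mul_nonneg (by positivity) hr.1.le
  have h2 : 0 ≤ 2 * D * a * (1 + J) := by positivity
  have h3 : 0 ≤ a * (δ / 2)⁻¹ * (1 + K * J) := by positivity
  linarith
end
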